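/- arXiv:2101.02618 — 5 statements merged into one kernel-verified Lean document; each statement's English description precedes it below -/
import Mathlib

section
/- Let S, T ∈ Sp(2k,2n). Then the column spans satisfy span(S) = span(T) if and only if there exists a symplectic matrix K ∈ Sp(2k) := Sp(2k,2k) such that T = SK. -/
open Matrix

noncomputable section

/-- Index type for `2n`-dimensional objects: first copy for indices `1..n`,
second copy for indices `n+1..2n`. -/
abbrev Idx (n : ℕ) := Fin n ⊕ Fin n

/-- The Poisson matrix `J_{2n} = [[0, I], [-I, 0]]`. -/
def Jmat (n : ℕ) : Matrix (Idx n) (Idx n) ℝ := fromBlocks 0 1 (-1) 0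

/-- `X ∈ Sp(2k, 2n)`, i.e. `Xᵀ J_{2n} X = J_{2k}`. -/
def Symplectic {n k : ℕ} (X : Matrix (Idx n) (Idx k) ℝ) : Prop :=
  Xᵀ * Jmat n * X = Jmat k

/-- `K ∈ OrSp(2n)`, i.e. `KᵀK = I` and `Kᵀ J K = J`. -/
def OrthoSymplectic {n : ℕ} (K : Matrix (Idx n) (Idx n) ℝ) : Prop :=
  Kᵀ * K = 1 ∧ Symplectic K

/-- The block-diagonal matrix `diag(D, D)` with `D = diagonal d`. -/
def diagPair {n : ℕ} (d : Fin n → ℝ) : Matrix (Idx n) (Idx n) ℝ :=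
  fromBlocks (diagonal d) 0 0 (diagonal d)

/-- The matrix `[[0, -Λ], [Λ, 0]]` with `Λ = diagonal lam`. -/
def offPair {k : ℕ} (lam : Fin k → ℝ) : Matrix (Idx k) (Idx k) ℝ :=
  fromBlocks 0 (-(diagonal lam)) (diagonal lam) 0

theorem Jmat_mul_Jmat (k : ℕ) : Jmat k * Jmat k = -1 := by
  simp [Jmat, fromBlocks_multiply, ← fromBlocks_one, fromBlocks_neg]

theorem neg_Jmat_mul_Jmat (k : ℕ) : -Jmat k * Jmat k = 1 := by
  simp [Jmat_mul_Jmat]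

theorem symplectic_mul_iff {n k : ℕ} {S : Matrix (Idx n) (Idx k) ℝ} (hS : Symplectic S)
    (K : Matrix (Idx k) (Idx k) ℝ) : Symplectic (S * K) ↔ Symplectic K := by
  unfold Symplectic at *
  rw [transpose_mul, ← hS]
  simp only [Matrix.mul_assoc]

theorem Symplectic.isUnit {k : ℕ} {K : Matrix (Idx k) (Idx k) ℝ} (hK : Symplectic K) :
    IsUnit K := by
  refine IsUnit.of_mul_eq_one (-Jmat k * (Kᵀ * Jmat k)) (mul_eq_one_comm.mp ?_)
  rw [Matrix.mul_assoc, show Kᵀ * Jmat k * K = Jmat k from hK, neg_Jmat_mul_Jmat]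

theorem exists_eq_mul_of_range_le {l m p R : Type*} [Fintype m] [Fintype p] [CommSemiring R]
    {A : Matrix l m R} {B : Matrix l p R}
    (h : LinearMap.range B.mulVecLin ≤ LinearMap.range A.mulVecLin) :
    ∃ C : Matrix m p R, B = A * C := by
  classical
  have hcol (j : p) : ∃ v : m → R, A *ᵥ v = B.col j :=
    h ⟨Pi.single j 1, by simp⟩
  choose C hC using hcol
  refine ⟨(of C)ᵀ, ?_⟩
  ext i j
  exact (congrFun (hC j) i).symm

theorem range_mulVecLin_mul_le {l m p R : Type*} [Fintype m] [Fintype p] [CommSemiring R]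
    (A : Matrix l m R) (B : Matrix m p R) :
    LinearMap.range (A * B).mulVecLin ≤ LinearMap.range A.mulVecLin := by
  rw [mulVecLin_mul]
  exact LinearMap.range_comp_le_range _ _

/-- two symplectic matrices in `Sp(2k,2n)` have the same column span
iff they differ by a symplectic matrix `K ∈ Sp(2k)` on the right. -/
theorem span_eq_iff_symplectic_factor {n k : ℕ} (hk : k ≤ n)
    (S T : Matrix (Idx n) (Idx k) ℝ) (hS : Symplectic S) (hT : Symplectic T) :
    LinearMap.range S.mulVecLin = LinearMap.range T.mulVecLin ↔
      ∃ K : Matrix (Idx k) (Idx k) ℝ, Symplectic K ∧ T = S * K := by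
  constructor
  · intro h
    obtain ⟨K, rfl⟩ := exists_eq_mul_of_range_le h.ge
    exact ⟨K, (symplectic_mul_iff hS K).mp hT, rfl⟩
  · rintro ⟨K, hK, rfl⟩
    refine le_antisymm ?_ (range_mulVecLin_mul_le S K)
    obtain ⟨L, hL⟩ := hK.isUnit.exists_right_inv
    calc LinearMap.range S.mulVecLin = LinearMap.range (S * K * L).mulVecLin := by
          rw [Matrix.mul_assoc, hL, Matrix.mul_one]
      _ ≤ LinearMap.range (S * K).mulVecLin := range_mulVecLin_mul_le _ L
end
end

section
/- (Williamson's theorem) For every symmetric positive-definite matrix M ∈ ℝ^{2n×2n} there exist a symplectic matrix S ∈ Sp(2n) and a diagonal matrix D = diag(d₁, ..., dₙ) with all dⱼ > 0 such that SᵀMS = diag(D, D) (the 2n×2n block-diagonal matrix with D in both diagonal blocks). -/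
open Matrix

noncomputable section

open scoped InnerProductSpace in
/-- A skew-adjoint injective endomorphism of an even-dimensional real inner product space is
block diagonal, with `2 × 2` skew-symmetric blocks, in a suitable orthonormal family. -/
theorem exists_orthonormal_of_skew (n : ℕ) {V : Type*} [NormedAddCommGroup V]
    [InnerProductSpace ℝ V] [FiniteDimensional ℝ V] (hV : Module.finrank ℝ V = 2 * n)
    (A : V →ₗ[ℝ] V) (hA : ∀ x y, ⟪A x, y⟫_ℝ = -⟪x, A y⟫_ℝ) (hinj : Function.Injective A) :
    ∃ (b : Idx n → V) (lam : Fin n → ℝ), Orthonormal ℝ b ∧ (∀ j, 0 < lam j) ∧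
      (∀ j, A (b (.inl j)) = -(lam j • b (.inr j))) ∧
      ∀ j, A (b (.inr j)) = lam j • b (.inl j) := by
  induction n generalizing V with
  | zero =>
    exact ⟨isEmptyElim, isEmptyElim, ⟨isEmptyElim, fun i => isEmptyElim i⟩,
      isEmptyElim, isEmptyElim, isEmptyElim⟩
  | succ n ih =>
    have : Nontrivial V := Module.nontrivial_of_finrank_pos (R := ℝ) (by omega)
    have hsymm : (A ∘ₗ A).IsSymmetric := fun x y => by simp [hA]
    obtain ⟨v, hv, hAv⟩ : ∃ v : V, ‖v‖ = 1 ∧ ∃ μ : ℝ, A (A v) = μ • v := by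
      have hμ := hsymm.hasEigenvalue_iSup_of_finiteDimensional
      obtain ⟨v, hv⟩ := hμ.exists_hasEigenvector
      refine ⟨(‖v‖⁻¹ : ℝ) • v, norm_smul_inv_norm (𝕜 := ℝ) hv.2, ⨆ x : {x : V // x ≠ 0}, RCLike.re ⟪(A ∘ₗ A) x, x⟫_ℝ / ‖(x : V)‖ ^ 2, ?_⟩
      have := hv.apply_eq_smul
      simp only [LinearMap.comp_apply] at this
      rw [map_smul, map_smul, this, smul_comm]
      rfl
    obtain ⟨μ, hμ⟩ := hAv
    have hvv : ⟪v, v⟫_ℝ = 1 := by simp [hv]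
    have hself (x : V) : ⟪x, A x⟫_ℝ = 0 := by
      have := hA x x
      rw [real_inner_comm] at this
      linarith
    set l : ℝ := ‖A v‖ with hl
    have hl0 : 0 < l := by
      rw [hl, norm_pos_iff, Ne, map_eq_zero_iff A hinj, ← norm_eq_zero, hv]
      exact one_ne_zero
    have hμl : μ = -l ^ 2 := by
      have h := hA v (A v)
      rw [hμ, inner_smul_right, hvv, real_inner_self_eq_norm_sq] at h
      linarith
    set w : V := -(l⁻¹ • A v) with hw
    have hAv : A v = -(l • w) := by simp [hw, smul_smul, hl0.ne']
    have hAw : A w = l • v := by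
      rw [hw, map_neg, map_smul, hμ, hμl, smul_smul, ← neg_smul]
      congr 1
      field_simp
    have hww : ⟪w, w⟫_ℝ = 1 := by
      rw [real_inner_self_eq_norm_sq, hw, norm_neg, norm_smul, ← hl]
      simp [abs_of_pos hl0, hl0.ne']
    have hvw : ⟪v, w⟫_ℝ = 0 := by simp [hw, inner_smul_right, hself]
    have hwv : ⟪w, v⟫_ℝ = 0 := (real_inner_comm _ _).trans hvw
    have hvw_orth : Orthonormal ℝ ![v, w] := by
      rw [orthonormal_iff_ite]
      simp only [Fin.forall_fin_two]
      simp [-inner_self_eq_norm_sq_to_K, hvv, hvw, hww, hwv]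
    set U : Submodule ℝ V := Submodule.span ℝ (Set.range ![v, w])
    have hmem (x : V) : x ∈ Uᗮ ↔ ⟪v, x⟫_ℝ = 0 ∧ ⟪w, x⟫_ℝ = 0 := by
      constructor
      · intro h
        exact ⟨h v (Submodule.subset_span ⟨0, rfl⟩), h w (Submodule.subset_span ⟨1, rfl⟩)⟩
      · rintro ⟨h1, h2⟩
        rw [Submodule.mem_orthogonal]
        intro u hu
        induction hu using Submodule.span_induction with
        | mem u hu =>
          obtain ⟨i, rfl⟩ := hu
          fin_cases i
          exacts [h1, h2]
        | zero => simp
        | add a b _ _ ha hb => rw [inner_add_left, ha, hb, add_zero]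
        | smul a b _ hb => rw [inner_smul_left, hb, mul_zero]
    have hinv : ∀ x ∈ Uᗮ, A x ∈ Uᗮ := by
      intro x hx
      rw [hmem] at hx ⊢
      have h1 := hA v x
      have h2 := hA w x
      rw [hAv, inner_neg_left, inner_smul_left, hx.2] at h1
      rw [hAw, inner_smul_left, hx.1] at h2
      simp only [mul_zero, neg_zero, zero_eq_neg] at h1 h2
      exact ⟨h1, h2⟩
    have hU : Module.finrank ℝ Uᗮ = 2 * n := by
      have h1 : Module.finrank ℝ U = 2 := by
        simpa using finrank_span_eq_card hvw_orth.linearIndependent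
      have := U.finrank_add_finrank_orthogonal
      omega
    obtain ⟨b, lam, hb, hlam, hb1, hb2⟩ := ih hU (A.restrict hinv)
      (fun x y => by simpa using hA x y)
      (fun x y h => Subtype.ext (hinj (congrArg Subtype.val h)))
    have hvb (i) : ⟪v, b i⟫_ℝ = 0 := ((hmem _).1 (b i).2).1
    have hwb (i) : ⟪w, b i⟫_ℝ = 0 := ((hmem _).1 (b i).2).2
    have hbv (i) : ⟪(b i : V), v⟫_ℝ = 0 := (real_inner_comm _ _).trans (hvb i)
    have hbw (i) : ⟪(b i : V), w⟫_ℝ = 0 := (real_inner_comm _ _).trans (hwb i)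
    have hbb (i j) : ⟪(b i : V), b j⟫_ℝ = if i = j then 1 else 0 :=
      orthonormal_iff_ite.1 hb i j
    refine ⟨Sum.elim (Fin.cons v fun j => b (.inl j)) (Fin.cons w fun j => b (.inr j)),
      Fin.cons l lam, ?_, ?_, ?_, ?_⟩
    · rw [orthonormal_iff_ite]
      rintro (i | i) (j | j) <;> refine Fin.cases ?_ (fun i => ?_) i <;>
        refine Fin.cases ?_ (fun j => ?_) j <;>
        simp [hvv, hww, hvw, hwv, hvb, hwb, hbv, hbw, hbb,
          -inner_self_eq_norm_sq_to_K, Fin.succ_ne_zero, (Fin.succ_ne_zero _).symm]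
    · exact Fin.cases hl0 hlam
    · exact Fin.cases hAv fun j => congrArg Subtype.val (hb1 j)
    · exact Fin.cases hAw fun j => congrArg Subtype.val (hb2 j)

/-- Orthogonal normal form of an invertible real skew-symmetric matrix. -/
theorem exists_orthogonal_of_skew {n : ℕ} (A : Matrix (Idx n) (Idx n) ℝ) (hA : Aᵀ = -A)
    (hdet : IsUnit A) :
    ∃ (K : Matrix (Idx n) (Idx n) ℝ) (lam : Fin n → ℝ), Kᵀ * K = 1 ∧ (∀ j, 0 < lam j) ∧
      Kᵀ * A * K = fromBlocks 0 (diagonal lam) (-diagonal lam) 0 := by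
  obtain ⟨b, lam, hb, hlam, hb1, hb2⟩ := exists_orthonormal_of_skew n
    (V := EuclideanSpace ℝ (Idx n)) (by simp [two_mul]) (toEuclideanLin A)
    (fun x y => by
      rw [← LinearMap.adjoint_inner_right, ← toEuclideanLin_conjTranspose_eq_adjoint,
        conjTranspose_eq_transpose_of_trivial, hA, map_neg, LinearMap.neg_apply, inner_neg_right])
    (fun x y h => by
      have h' := congrArg WithLp.ofLp h
      simp only [ofLp_toLpLin, toLin'_apply] at h'
      exact WithLp.ofLp_injective 2 (mulVec_injective_iff_isUnit.2 hdet h'))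
  have hbb := orthonormal_iff_ite.1 hb
  set K : Matrix (Idx n) (Idx n) ℝ := of fun i j => b j i
  have key (C : Matrix (Idx n) (Idx n) ℝ) (i j) :
      (Kᵀ * C * K) i j = inner ℝ (b i) (toEuclideanLin C (b j)) := by
    rw [EuclideanSpace.inner_eq_star_dotProduct, star_trivial, ofLp_toLpLin, toLin'_apply,
      Matrix.mul_assoc, dotProduct_comm]
    rfl
  refine ⟨K, lam, ?_, hlam, ?_⟩
  · ext i j
    have h := key 1 i j
    rw [Matrix.mul_one, toLpLin_apply, one_mulVec, hbb] at h
    simpa [one_apply] using h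
  · ext i j
    rw [key]
    rcases i with i | i <;> rcases j with j | j <;>
      simp [hb1, hb2, inner_smul_right, hbb, diagonal_apply, -inner_self_eq_norm_sq_to_K] <;>
      grind

open scoped MatrixOrder in
/-- A real positive-definite matrix is of the form `BᵀB` with `B` invertible. -/
theorem Matrix.PosDef.exists_isUnit_transpose_mul_self {m : Type*} [Fintype m] [DecidableEq m]
    {M : Matrix m m ℝ} (hM : M.PosDef) : ∃ B : Matrix m m ℝ, IsUnit B ∧ M = Bᵀ * B := by
  obtain ⟨B, hB, rfl⟩ :=
    CStarAlgebra.isStrictlyPositive_iff_eq_star_mul_self.1 hM.isStrictlyPositive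
  exact ⟨B, hB, by rw [star_eq_conjTranspose, conjTranspose_eq_transpose_of_trivial]⟩

/-- Williamson's theorem: every symmetric positive-definite
`M ∈ ℝ^{2n×2n}` can be symplectically diagonalized as `SᵀMS = diag(D, D)`
with `D` a positive diagonal matrix. -/
theorem williamson {n : ℕ} (M : Matrix (Idx n) (Idx n) ℝ) (hM : M.PosDef) :
    ∃ (S : Matrix (Idx n) (Idx n) ℝ) (d : Fin n → ℝ),
      Symplectic S ∧ (∀ j, 0 < d j) ∧ Sᵀ * M * S = diagPair d := by
  obtain ⟨B, hB, rfl⟩ : ∃ B, IsUnit B ∧ M = Bᵀ * B := hM.exists_isUnit_transpose_mul_self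
  have hdet := (isUnit_iff_isUnit_det B).1 hB
  have hBB : B * B⁻¹ = 1 := mul_nonsing_inv B hdet
  have hBBt : (B⁻¹)ᵀ * Bᵀ = 1 := by rw [← transpose_mul, hBB, transpose_one]
  have hJ : IsUnit (Jmat n) :=
    .of_mul_eq_one (-Jmat n) (by simp [Jmat, fromBlocks_multiply, fromBlocks_neg])
  have hJt : (Jmat n)ᵀ = -Jmat n := by simp [Jmat, fromBlocks_transpose, fromBlocks_neg]
  have hBi : IsUnit B⁻¹ := isUnit_nonsing_inv_iff.2 hB
  obtain ⟨K, lam, hK, hlam, hKA⟩ := exists_orthogonal_of_skew ((B⁻¹)ᵀ * Jmat n * B⁻¹)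
    (by simp [hJt, Matrix.mul_assoc])
    (((isUnit_transpose _).2 hBi).mul hJ |>.mul hBi)
  set c : Fin n → ℝ := fun j => (√(lam j))⁻¹ with hc
  have hcc (j) : c j * c j = (lam j)⁻¹ := by
    rw [hc, ← mul_inv, Real.mul_self_sqrt (hlam j).le]
  have hclc (j) : c j * lam j * c j = 1 := by
    rw [mul_right_comm, hcc, inv_mul_cancel₀ (hlam j).ne']
  have hL : (diagPair c)ᵀ = diagPair c := by simp [diagPair]
  refine ⟨B⁻¹ * K * diagPair c, fun j => (lam j)⁻¹, ?_, fun j => inv_pos.2 (hlam j), ?_⟩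
  · calc (B⁻¹ * K * diagPair c)ᵀ * Jmat n * (B⁻¹ * K * diagPair c)
        = diagPair c * (Kᵀ * ((B⁻¹)ᵀ * Jmat n * B⁻¹) * K) * diagPair c := by
          simp only [transpose_mul, hL, Matrix.mul_assoc]
      _ = Jmat n := by
          rw [hKA]
          simp only [diagPair, Jmat, fromBlocks_multiply, diagonal_mul_diagonal, diagonal_neg]
          simp [hclc, ← diagonal_one]
  · calc (B⁻¹ * K * diagPair c)ᵀ * (Bᵀ * B) * (B⁻¹ * K * diagPair c)
        = diagPair c * (Kᵀ * (((B⁻¹)ᵀ * Bᵀ) * (B * B⁻¹)) * K) * diagPair c := by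
          simp only [transpose_mul, hL, Matrix.mul_assoc]
      _ = diagPair fun j => (lam j)⁻¹ := by
          rw [hBB, hBBt, Matrix.mul_one, Matrix.mul_one, hK]
          simp [diagPair, hcc]
end
end

section
/- Let N ∈ ℝ^{2n×2n} be symmetric positive-definite and skew-Hamiltonian (i.e., (J_{2n}ᵀN)ᵀ = −J_{2n}ᵀN). If S ∈ Sp(2n) satisfies SᵀNS = diag(D, D) for a positive diagonal matrix D = diag(d₁, ..., dₙ), then S is orthosymplectic, i.e., SᵀS = I_{2n}. -/
open Matrix

noncomputable section

theorem Jmat_mul_self (n : ℕ) : Jmat n * Jmat n = -1 := by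
  simp [Jmat, fromBlocks_multiply, ← fromBlocks_one, fromBlocks_neg]

theorem Jmat_transpose (n : ℕ) : (Jmat n)ᵀ = -Jmat n := by
  simp [Jmat, fromBlocks_transpose, fromBlocks_neg]

/-- The transpose of a square symplectic matrix is symplectic. -/
theorem Symplectic.mul_Jmat_mul_transpose {n : ℕ} {S : Matrix (Idx n) (Idx n) ℝ}
    (hS : Symplectic S) : S * Jmat n * Sᵀ = Jmat n := by
  have hJ := Jmat_mul_self n
  have hleft : -(Jmat n * Sᵀ * Jmat n) * S = 1 := by
    calc -(Jmat n * Sᵀ * Jmat n) * S = -(Jmat n * (Sᵀ * Jmat n * S)) := by noncomm_ring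
      _ = 1 := by rw [hS, hJ, neg_neg]
  have hright := mul_eq_one_comm.mp hleft
  calc S * Jmat n * Sᵀ = S * -(Jmat n * Sᵀ * Jmat n) * Jmat n + S * Jmat n * Sᵀ *
        (1 + Jmat n * Jmat n) := by noncomm_ring
    _ = Jmat n := by rw [hright, hJ]; simp

/-- A matrix commuting with the square of a positive diagonal matrix commutes with that
diagonal matrix. -/
theorem commute_diagonal_of_commute_diagonal_sq {ι : Type*} [Fintype ι] [DecidableEq ι]
    {M : Matrix ι ι ℝ} {e : ι → ℝ} (he : ∀ i, 0 < e i)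
    (h : Commute (diagonal e * diagonal e) M) : Commute (diagonal e) M := by
  ext i j
  have hij := congrFun (congrFun h.eq i) j
  simp only [diagonal_mul_diagonal, diagonal_mul, mul_diagonal] at hij ⊢
  have hprod : (e i + e j) * (e i * M i j - M i j * e j) = 0 := by linarith
  have hpos := add_pos (he i) (he j)
  exact sub_eq_zero.mp ((mul_eq_zero.mp hprod).resolve_left hpos.ne')

/-- A positive semidefinite involution is the identity. -/
theorem Matrix.PosSemidef.eq_one_of_mul_self_eq_one {ι : Type*} [Fintype ι] [DecidableEq ι]
    {M : Matrix ι ι ℝ} (hM : M.PosSemidef) (h : M * M = 1) : M = 1 := by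
  have hunit : IsUnit (M + 1) := (PosDef.posSemidef_add hM PosDef.one).isUnit
  refine sub_eq_zero.mp (hunit.mul_right_eq_zero.mp ?_)
  calc (M + 1) * (M - 1) = M * M - 1 := by noncomm_ring
    _ = 0 := by rw [h, sub_self]

/-- a symplectic matrix diagonalizing an spd skew-Hamiltonian
matrix is orthosymplectic. -/
theorem diagonalizing_skewHamiltonian_is_orthogonal {n : ℕ}
    (N : Matrix (Idx n) (Idx n) ℝ) (hN : N.PosDef)
    (hskew : ((Jmat n)ᵀ * N)ᵀ = -((Jmat n)ᵀ * N))
    (S : Matrix (Idx n) (Idx n) ℝ) (hS : Symplectic S)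
    (d : Fin n → ℝ) (hd : ∀ j, 0 < d j) (hdiag : Sᵀ * N * S = diagPair d) :
    Sᵀ * S = 1 := by
  have hJ := Jmat_mul_self n
  have hSt := hS.mul_Jmat_mul_transpose
  have hNJ : N * Jmat n = Jmat n * N := by
    have hsymm : Nᵀ = N := by simpa using hN.1.eq
    rw [transpose_mul, transpose_transpose, hsymm, Jmat_transpose] at hskew
    simpa using hskew
  have hE : diagPair d = diagonal (Sum.elim d d) := by
    simp [diagPair, fromBlocks_diagonal]
  have hEJ : diagPair d * Jmat n = Jmat n * diagPair d := by
    rw [diagPair, Jmat, fromBlocks_multiply, fromBlocks_multiply]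
    simp
  have hM : (Sᵀ * S).PosSemidef := by
    simpa using posSemidef_conjTranspose_mul_self S
  have hMJM : (Sᵀ * S) * Jmat n * (Sᵀ * S) = Jmat n := by
    calc (Sᵀ * S) * Jmat n * (Sᵀ * S) = Sᵀ * (S * Jmat n * Sᵀ) * S := by noncomm_ring
      _ = Jmat n := by rw [hSt, hS]
  have hcomm : diagPair d * Jmat n * (Sᵀ * S) = (Sᵀ * S) * (diagPair d * Jmat n) := by
    calc diagPair d * Jmat n * (Sᵀ * S)
        = Sᵀ * N * (S * Jmat n * Sᵀ) * S := by rw [← hdiag]; noncomm_ring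
      _ = Sᵀ * (N * Jmat n) * S := by rw [hSt]; noncomm_ring
      _ = Sᵀ * (S * Jmat n * Sᵀ) * N * S := by rw [hNJ, hSt]; noncomm_ring
      _ = (Sᵀ * S) * (Jmat n * (Sᵀ * N * S)) := by noncomm_ring
      _ = (Sᵀ * S) * (diagPair d * Jmat n) := by rw [hdiag, hEJ]
  generalize Sᵀ * S = M at *
  have hKK : (diagPair d * Jmat n) * (diagPair d * Jmat n) = -(diagPair d * diagPair d) := by
    calc (diagPair d * Jmat n) * (diagPair d * Jmat n)
        = diagPair d * (Jmat n * diagPair d) * Jmat n := by noncomm_ring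
      _ = diagPair d * diagPair d * (Jmat n * Jmat n) := by rw [← hEJ]; noncomm_ring
      _ = -(diagPair d * diagPair d) := by rw [hJ]; simp
  have hpos : ∀ i, 0 < Sum.elim d d i := by
    rintro (i | i) <;> exact hd i
  have hEM : Commute (diagPair d) M := by
    have hK : Commute (diagPair d * Jmat n) M := hcomm
    have hsq := hK.mul_left hK
    rw [hKK, Commute.neg_left_iff, hE] at hsq
    rw [hE]
    exact commute_diagonal_of_commute_diagonal_sq hpos hsq
  have hEunit : IsUnit (diagPair d) := by
    rw [hE]
    exact (PosDef.diagonal hpos).isUnit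
  have hJM : Jmat n * M = M * Jmat n := by
    refine hEunit.mul_left_cancel ?_
    rw [← mul_assoc, hcomm, ← mul_assoc, ← mul_assoc, hEM.eq]
  refine hM.eq_one_of_mul_self_eq_one ?_
  calc M * M = -(M * M * (Jmat n * Jmat n)) := by rw [hJ]; simp
    _ = -(M * (M * Jmat n) * Jmat n) := by noncomm_ring
    _ = -(M * Jmat n * M * Jmat n) := by rw [mul_assoc M (Jmat n) M, hJM]
    _ = 1 := by rw [hMJM, hJ, neg_neg]
end
end

section
/- Let N ∈ ℝ^{2n×2n} be symmetric positive-definite and skew-Hamiltonian (i.e., (J_{2n}ᵀN)ᵀ = −J_{2n}ᵀN). Then there exists an orthosymplectic matrix K ∈ OrSp(2n) and a positive diagonal matrix D = diag(d₁, ..., dₙ) such that KᵀNK = diag(D, D); in particular, the standard eigenvalues of N are exactly d₁, ..., dₙ, each with doubled multiplicity, so the symplectic eigenvalues of N coincide with its standard eigenvalues. -/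
open Matrix

noncomputable section

/-- The real representation `X + iY ↦ [[X, Y], [-Y, X]]` of complex matrices. -/
def realRep {n : ℕ} (M : Matrix (Fin n) (Fin n) ℂ) : Matrix (Idx n) (Idx n) ℝ :=
  fromBlocks (M.map Complex.re) (M.map Complex.im) (-(M.map Complex.im)) (M.map Complex.re)

theorem realRep_mul {n : ℕ} (M P : Matrix (Fin n) (Fin n) ℂ) :
    realRep (M * P) = realRep M * realRep P := by
  ext (i | i) (j | j) <;>
    simp [realRep, mul_apply, Finset.sum_sub_distrib,
      Finset.sum_add_distrib] <;> ring

theorem realRep_conjTranspose {n : ℕ} (M : Matrix (Fin n) (Fin n) ℂ) :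
    realRep Mᴴ = (realRep M)ᵀ := by
  ext (i | i) (j | j) <;> simp [realRep]

theorem realRep_one {n : ℕ} : realRep (1 : Matrix (Fin n) (Fin n) ℂ) = 1 := by
  ext (i | i) (j | j) <;> simp [realRep, one_apply, apply_ite]

theorem realRep_I {n : ℕ} :
    realRep (Complex.I • (1 : Matrix (Fin n) (Fin n) ℂ)) = Jmat n := by
  ext (i | i) (j | j) <;> simp [realRep, Jmat, one_apply, apply_ite]

theorem realRep_diagonal {n : ℕ} (d : Fin n → ℝ) :
    realRep (diagonal fun i => (d i : ℂ)) = diagPair d := by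
  ext (i | i) (j | j) <;> by_cases h : i = j <;> simp [realRep, diagPair, h]

theorem realRep_injective {n : ℕ} : Function.Injective (realRep (n := n)) := by
  intro M P h
  obtain ⟨hre, him, -, -⟩ := fromBlocks_inj.mp h
  ext i j
  exact Complex.ext (congrFun (congrFun hre i) j) (congrFun (congrFun him i) j)

/-- A real matrix commuting with the Poisson matrix represents a complex matrix. -/
theorem exists_realRep_eq {n : ℕ} (N : Matrix (Idx n) (Idx n) ℝ)
    (h : N * Jmat n = Jmat n * N) : ∃ M, realRep M = N := by
  rw [← fromBlocks_toBlocks N, Jmat, fromBlocks_multiply, fromBlocks_multiply] at h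
  obtain ⟨h₁, h₂, -, -⟩ := fromBlocks_inj.mp (by simpa using h)
  refine ⟨of fun i j => ⟨N.toBlocks₁₁ i j, N.toBlocks₁₂ i j⟩, ?_⟩
  conv_rhs => rw [← fromBlocks_toBlocks N, ← h₁, ← h₂]
  rfl

/-- Unitary matrices are represented by orthosymplectic matrices. -/
theorem orthoSymplectic_realRep {n : ℕ} (U : Matrix (Fin n) (Fin n) ℂ) (hU : Uᴴ * U = 1) :
    OrthoSymplectic (realRep U) := by
  constructor
  · rw [← realRep_conjTranspose, ← realRep_mul, hU, realRep_one]
  · rw [Symplectic, ← realRep_conjTranspose, ← realRep_I, ← realRep_mul, ← realRep_mul]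
    simp [hU]

theorem diagPair_eq_diagonal {n : ℕ} (d : Fin n → ℝ) :
    diagPair d = diagonal (Sum.elim d d) :=
  fromBlocks_diagonal d d

theorem charpoly_diagPair {n : ℕ} (d : Fin n → ℝ) :
    (diagPair d).charpoly = ∏ j : Fin n, (Polynomial.X - Polynomial.C (d j)) ^ 2 := by
  simp [diagPair_eq_diagonal, charpoly_diagonal, Fintype.prod_sum_type,
    ← Finset.prod_mul_distrib, sq]

/-- an spd skew-Hamiltonian matrix `N` can be diagonalized by an
orthosymplectic matrix, `KᵀNK = diag(D,D)`; the standard eigenvalues of `N` are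
exactly `d₁, …, dₙ`, each with doubled multiplicity (so they coincide with the
symplectic eigenvalues of `N`). -/
theorem skewHamiltonian_williamson {n : ℕ}
    (N : Matrix (Idx n) (Idx n) ℝ) (hN : N.PosDef)
    (hskew : ((Jmat n)ᵀ * N)ᵀ = -((Jmat n)ᵀ * N)) :
    ∃ (K : Matrix (Idx n) (Idx n) ℝ) (d : Fin n → ℝ),
      OrthoSymplectic K ∧ (∀ j, 0 < d j) ∧ Kᵀ * N * K = diagPair d ∧
      N.charpoly = ∏ j : Fin n, (Polynomial.X - Polynomial.C (d j)) ^ 2 := by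
  have hNt : Nᵀ = N := by simpa using hN.isHermitian.eq
  have hJt : (Jmat n)ᵀ = -Jmat n := by simp [Jmat, fromBlocks_transpose, fromBlocks_neg]
  have hcomm : N * Jmat n = Jmat n * N := by
    simpa [transpose_mul, hNt, hJt] using hskew
  obtain ⟨M, rfl⟩ := exists_realRep_eq N hcomm
  have hM : M.IsHermitian :=
    realRep_injective (by rw [realRep_conjTranspose, hNt])
  set U : Matrix (Fin n) (Fin n) ℂ := ↑hM.eigenvectorUnitary
  have hU : Uᴴ * U = 1 := Unitary.coe_star_mul_self hM.eigenvectorUnitary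
  have hdiag : Uᴴ * M * U = diagonal fun i => (hM.eigenvalues i : ℂ) := by
    have h := hM.conjStarAlgAut_star_eigenvectorUnitary
    rw [Unitary.conjStarAlgAut_star_apply] at h
    exact h
  have hK := orthoSymplectic_realRep U hU
  have hKN : (realRep U)ᵀ * realRep M * realRep U = diagPair hM.eigenvalues := by
    rw [← realRep_conjTranspose, ← realRep_mul, ← realRep_mul, hdiag, realRep_diagonal]
  refine ⟨realRep U, hM.eigenvalues, hK, fun j => ?_, hKN, ?_⟩
  · have hpos : (diagPair hM.eigenvalues).PosDef := by
      rw [← hKN]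
      have := hN.conjTranspose_mul_mul_same (B := realRep U)
        (mulVec_injective_of_isUnit (.of_mul_eq_one_right _ hK.1))
      simpa using this
    simpa [diagPair] using hpos.diag_pos (i := Sum.inl j)
  · rw [← charpoly_diagPair, ← hKN, charpoly_mul_comm, ← Matrix.mul_assoc,
      mul_eq_one_comm.mp hK.1, Matrix.one_mul]
end
end

section
/- Let M ∈ ℝ^{2n×2n} be symmetric positive-definite with symplectic eigenvalues d₁ ≤ ... ≤ dₙ, and consider the case k = n. Every critical point of the trace minimization problem is a global minimizer: if X ∈ Sp(2n) and there exists a skew-symmetric L ∈ ℝ^{2n×2n} with MX = J_{2n}XL, then tr(XᵀMX) = 2(d₁ + ... + dₙ) ≤ tr(YᵀMY) for all Y ∈ Sp(2n). -/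
open Matrix

noncomputable section

theorem Jmat_mul_diagPair {n : ℕ} (d : Fin n → ℝ) :
    Jmat n * diagPair d = diagPair d * Jmat n := by
  simp only [Jmat, diagPair, fromBlocks_multiply]; simp

theorem diagPair_posDef {n : ℕ} {d : Fin n → ℝ} (hd : ∀ j, 0 < d j) :
    (diagPair d).PosDef := by
  rw [diagPair_eq_diagonal]
  exact PosDef.diagonal (by rintro (j | j) <;> exact hd j)

theorem trace_diagPair {n : ℕ} (d : Fin n → ℝ) : (diagPair d).trace = 2 * ∑ j, d j := by
  rw [diagPair_eq_diagonal, trace_diagonal, Fintype.sum_sum_type]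
  simp [two_mul]

namespace Symplectic

variable {n : ℕ} {Z : Matrix (Idx n) (Idx n) ℝ}

theorem leftInverse_mul (hZ : Symplectic Z) : (-(Jmat n * Zᵀ * Jmat n)) * Z = 1 := by
  have h : Zᵀ * Jmat n * Z = Jmat n := hZ
  rw [Matrix.neg_mul, Matrix.mul_assoc, Matrix.mul_assoc, ← Matrix.mul_assoc Zᵀ, h,
    Jmat_mul_self, neg_neg]

theorem mul_rightInverse (hZ : Symplectic Z) : Z * (-(Jmat n * Zᵀ * Jmat n)) = 1 :=
  mul_eq_one_comm.mp hZ.leftInverse_mul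

theorem mul_Jmat_mul_transpose_s15 (hZ : Symplectic Z) : Z * Jmat n * Zᵀ = Jmat n := by
  have h := congrArg (· * Jmat n) hZ.mul_rightInverse
  simpa [Matrix.mul_assoc, Jmat_mul_self] using h

/-- Any two square symplectic matrices differ by a symplectic right factor. -/
theorem exists_eq_mul {S X : Matrix (Idx n) (Idx n) ℝ} (hS : Symplectic S) (hX : Symplectic X) :
    ∃ Z, Symplectic Z ∧ X = S * Z := by
  have hSX : S * (-(Jmat n * Sᵀ * Jmat n) * X) = X := by
    rw [← Matrix.mul_assoc, hS.mul_rightInverse, Matrix.one_mul]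
  refine ⟨-(Jmat n * Sᵀ * Jmat n) * X, ?_, hSX.symm⟩
  generalize -(Jmat n * Sᵀ * Jmat n) * X = Z at hSX
  subst hSX
  have h : (S * Z)ᵀ * Jmat n * (S * Z) = Jmat n := hX
  have h' : Sᵀ * Jmat n * S = Jmat n := hS
  calc Zᵀ * Jmat n * Z = Zᵀ * (Sᵀ * Jmat n * S) * Z := by rw [h']
    _ = (S * Z)ᵀ * Jmat n * (S * Z) := by simp only [transpose_mul, Matrix.mul_assoc]
    _ = Jmat n := h

/-- Expand `0 ≤ tr ((Z + J Z J)ᵀ diag(D, D) (Z + J Z J))`. -/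
theorem trace_diagPair_le {d : Fin n → ℝ} (hd : ∀ j, 0 < d j) (hZ : Symplectic Z) :
    (diagPair d).trace ≤ (Zᵀ * diagPair d * Z).trace := by
  have hD := (diagPair_posDef hd).posSemidef
  have hDJ := Jmat_mul_diagPair d
  have hDt : (diagPair d)ᵀ = diagPair d := by simp [diagPair_eq_diagonal]
  have hJJ := Jmat_mul_self n
  have hinv := hZ.mul_rightInverse
  generalize diagPair d = D at *
  set J := Jmat n with hJ
  have hnonneg := (hD.conjTranspose_mul_mul_same (Z + J * Z * J)).trace_nonneg
  rw [conjTranspose_eq_transpose_of_trivial] at hnonneg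
  have hcross : (Zᵀ * D * (J * Z * J)).trace = -D.trace := by
    calc (Zᵀ * D * (J * Z * J)).trace = (Zᵀ * (D * J) * Z * J).trace := by
          simp only [Matrix.mul_assoc]
      _ = (J * (Zᵀ * (J * D) * Z)).trace := by rw [hDJ, trace_mul_comm]
      _ = ((J * Zᵀ * J * D) * Z).trace := by simp only [Matrix.mul_assoc]
      _ = -(Z * (-(J * Zᵀ * J)) * D).trace := by
          rw [trace_mul_comm]; simp [Matrix.mul_assoc]
      _ = -D.trace := by rw [hinv, Matrix.one_mul]
  have hcross' : ((J * Z * J)ᵀ * D * Z).trace = -D.trace := by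
    rw [← hcross, ← trace_transpose]
    simp only [transpose_mul, transpose_transpose, hDt, Matrix.mul_assoc]
  have hsquare : ((J * Z * J)ᵀ * D * (J * Z * J)).trace = (Zᵀ * D * Z).trace := by
    calc ((J * Z * J)ᵀ * D * (J * Z * J)).trace
        = (J * (Zᵀ * (J * D) * J * Z) * J).trace := by
          simp [transpose_mul, hJ, Jmat_transpose, Matrix.mul_assoc]
      _ = (J * J * (Zᵀ * (D * (J * J)) * Z)).trace := by
          rw [trace_mul_comm, hDJ]; simp only [Matrix.mul_assoc]
      _ = (Zᵀ * D * Z).trace := by simp [hJJ]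
  have hexpand : ((Z + J * Z * J)ᵀ * D * (Z + J * Z * J)).trace =
      (Zᵀ * D * Z).trace + (Zᵀ * D * (J * Z * J)).trace + ((J * Z * J)ᵀ * D * Z).trace
        + ((J * Z * J)ᵀ * D * (J * Z * J)).trace := by
    rw [transpose_add, Matrix.add_mul, Matrix.add_mul, Matrix.mul_add, Matrix.mul_add]
    simp only [trace_add]; ring
  linarith

end Symplectic

/-- A homogeneous Sylvester equation `D W + W A = 0` with `D` positive definite and `A` positive
semidefinite has only the zero solution. -/
theorem eq_zero_of_mul_add_mul_eq_zero {m : Type*} [Fintype m] [DecidableEq m]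
    {D A W : Matrix m m ℝ} (hD : D.PosDef) (hA : A.PosSemidef) (h : D * W + W * A = 0) :
    W = 0 := by
  have h₁ := hD.posSemidef.conjTranspose_mul_mul_same W
  have h₂ := (hA.mul_mul_conjTranspose_same W).trace_nonneg
  have hDW : D * W = -(W * A) := eq_neg_of_add_eq_zero_left h
  have htr : (Wᴴ * D * W).trace = -(W * A * Wᴴ).trace := by
    rw [Matrix.mul_assoc, hDW, Matrix.mul_neg, trace_neg, trace_mul_comm]
  have hzero : Wᴴ * D * W = 0 :=
    h₁.trace_eq_zero_iff.mp (le_antisymm (by linarith) h₁.trace_nonneg)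
  ext i j
  by_contra hij
  have hpos := hD.dotProduct_mulVec_pos (x := W.col j) (fun h0 => hij (congrFun h0 i))
  have hjj := congrFun (congrFun hzero j) j
  rw [Matrix.mul_assoc] at hjj
  exact hpos.ne' hjj

/-- If `Zᵀ diag(D, D) Z` commutes with `J` for a symplectic `Z`, then it is also equal to
`Z⁻¹ diag(D, D) Z`. -/
theorem Symplectic.mul_eq_diagPair_mul {n : ℕ} {Z A : Matrix (Idx n) (Idx n) ℝ} {d : Fin n → ℝ}
    (hZ : Symplectic Z) (hd : ∀ j, 0 < d j) (hA : A = Zᵀ * diagPair d * Z)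
    (hAJ : A * Jmat n = Jmat n * A) : Z * A = diagPair d * Z := by
  have hD := diagPair_posDef hd
  have hDJ := Jmat_mul_diagPair d
  have hpsd : A.PosSemidef := by
    rw [hA, ← conjTranspose_eq_transpose_of_trivial]
    exact hD.posSemidef.conjTranspose_mul_mul_same Z
  have hZJA : Z * (Jmat n * A) = Jmat n * (diagPair d * Z) := by
    rw [hA]
    calc Z * (Jmat n * (Zᵀ * diagPair d * Z)) = Z * Jmat n * Zᵀ * (diagPair d * Z) := by
          simp only [Matrix.mul_assoc]
      _ = _ := by rw [hZ.mul_Jmat_mul_transpose_s15]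
  have hsq : Z * (A * A) = diagPair d * (diagPair d * Z) := by
    calc Z * (A * A) = -(Z * (Jmat n * Jmat n * A * A)) := by simp [Jmat_mul_self]
      _ = -(Z * (Jmat n * A) * (Jmat n * A)) := by
          rw [Matrix.mul_assoc Z, ← Matrix.mul_assoc (Jmat n * A), Matrix.mul_assoc _ A (Jmat n), hAJ,
            ← Matrix.mul_assoc (Jmat n) (Jmat n) A]
      _ = -(Jmat n * diagPair d * (Z * (Jmat n * A))) := by
          rw [hZJA]; simp only [Matrix.mul_assoc]; rw [hZJA]
      _ = -(diagPair d * (Jmat n * Jmat n) * (diagPair d * Z)) := by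
          rw [hZJA, hDJ]; simp only [Matrix.mul_assoc]
      _ = _ := by simp [Jmat_mul_self]
  refine sub_eq_zero.mp (eq_zero_of_mul_add_mul_eq_zero hD hpsd ?_)
  rw [Matrix.mul_sub, Matrix.sub_mul, Matrix.mul_assoc Z, hsq, Matrix.mul_assoc (diagPair d)]
  abel

/-- in the case `k = n`, every critical point of the trace
minimization problem is a global minimizer, with value `2(d₁ + … + dₙ)`. -/
theorem critical_is_global_k_eq_n {n : ℕ}
    (M : Matrix (Idx n) (Idx n) ℝ) (hM : M.PosDef)
    (d : Fin n → ℝ) (hd : ∀ j, 0 < d j) (hmono : Monotone d)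
    (hW : ∃ S : Matrix (Idx n) (Idx n) ℝ, Symplectic S ∧ Sᵀ * M * S = diagPair d)
    (X : Matrix (Idx n) (Idx n) ℝ) (hX : Symplectic X)
    (L : Matrix (Idx n) (Idx n) ℝ) (hL : Lᵀ = -L)
    (hcrit : M * X = Jmat n * X * L) :
    (Xᵀ * M * X).trace = 2 * ∑ j : Fin n, d j ∧
      ∀ Y : Matrix (Idx n) (Idx n) ℝ, Symplectic Y →
        (Xᵀ * M * X).trace ≤ (Yᵀ * M * Y).trace := by
  obtain ⟨S, hS, hSM⟩ := hW
  have hconj (Z : Matrix (Idx n) (Idx n) ℝ) : (S * Z)ᵀ * M * (S * Z) = Zᵀ * diagPair d * Z := by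
    rw [← hSM]; simp only [transpose_mul, Matrix.mul_assoc]
  have htrace : (Xᵀ * M * X).trace = (diagPair d).trace := by
    have hMt : Mᵀ = M := by
      simpa only [conjTranspose_eq_transpose_of_trivial] using hM.isHermitian.eq
    have hAL : Xᵀ * M * X = Jmat n * L := by
      have h : Xᵀ * Jmat n * X = Jmat n := hX
      rw [Matrix.mul_assoc, hcrit, ← Matrix.mul_assoc, ← Matrix.mul_assoc, h]
    have hAt : (Xᵀ * M * X)ᵀ = Xᵀ * M * X := by
      simp only [transpose_mul, transpose_transpose, hMt, Matrix.mul_assoc]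
    have hLJ : L * Jmat n = Jmat n * L := by
      rw [hAL, transpose_mul, hL, Jmat_transpose, neg_mul_neg] at hAt
      exact hAt
    have hAJ : Xᵀ * M * X * Jmat n = Jmat n * (Xᵀ * M * X) := by
      rw [hAL, Matrix.mul_assoc, hLJ]
    obtain ⟨Z, hZ, rfl⟩ := hS.exists_eq_mul hX
    have hZA := hZ.mul_eq_diagPair_mul hd (hconj Z) hAJ
    generalize (S * Z)ᵀ * M * (S * Z) = A at hZA ⊢
    calc A.trace = (-(Jmat n * Zᵀ * Jmat n) * (Z * A)).trace := by
          rw [← Matrix.mul_assoc, hZ.leftInverse_mul, Matrix.one_mul]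
      _ = (Z * -(Jmat n * Zᵀ * Jmat n) * diagPair d).trace := by
          rw [hZA, trace_mul_comm, Matrix.mul_assoc, trace_mul_comm]
      _ = (diagPair d).trace := by rw [hZ.mul_rightInverse, Matrix.one_mul]
  refine ⟨htrace.trans (trace_diagPair d), fun Y hY => ?_⟩
  obtain ⟨Z, hZ, rfl⟩ := hS.exists_eq_mul hY
  rw [htrace, hconj]
  exact hZ.trace_diagPair_le hd
end
end
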